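/- arXiv:math-ph/0603055 — 2 statements merged into one kernel-verified Lean document; each statement's English description precedes it below -/
import Mathlib

section
/- Let d ≥ 1, ħ > 0, σ > 0, δ > 0 and r ≥ 1 a natural number with rδ < σ. With |z|, z ∧ z', the weighted norm ‖F‖_σ := ∫ e^{σ|s|}|F(s)| ds and the twisted convolution Mb_ħ(F,G)(s) := (2/ħ) ∫ F(s¹) G(s − s¹) sin(ħ (s ∧ s¹)/2) ds¹ defined as before on ℝ^{2d}, let F, G : ℝ^{2d} → ℂ be measurable with ‖F‖_σ < ∞, ‖G‖_σ < ∞, and define recursively H_0 := G and H_k := Mb_ħ(F, H_{k−1}) for k ≥ 1. Then ∫ e^{(σ − rδ)|s|} |H_r(s)| ds ≤ (1/(e²δ²))^r · ‖F‖_σ^r · ‖G‖_σ. -/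
open MeasureTheory
open scoped RealInnerProductSpace

/-- `|z| = ‖v‖ + ‖w‖` for `z = (v,w)`, with Euclidean norms on each factor. -/
noncomputable def phaseAbs {d : ℕ}
    (z : EuclideanSpace ℝ (Fin d) × EuclideanSpace ℝ (Fin d)) : ℝ :=
  ‖z.1‖ + ‖z.2‖

/-- The symplectic pairing `z ∧ z' = ⟨w, v'⟩ - ⟨v, w'⟩` for `z = (v,w)`, `z' = (v',w')`. -/
noncomputable def wedge {d : ℕ}
    (z z' : EuclideanSpace ℝ (Fin d) × EuclideanSpace ℝ (Fin d)) : ℝ :=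
  ⟪z.2, z'.1⟫ - ⟪z.1, z'.2⟫

/-- The twisted convolution arising as Fourier transform of the Moyal bracket:
`Mb_hbar(F,G)(s) = (2/hbar) ∫ F(s¹) G(s-s¹) sin(hbar (s ∧ s¹)/2) ds¹`. -/
noncomputable def moyalConv {d : ℕ} (hbar : ℝ)
    (F G : EuclideanSpace ℝ (Fin d) × EuclideanSpace ℝ (Fin d) → ℂ)
    (s : EuclideanSpace ℝ (Fin d) × EuclideanSpace ℝ (Fin d)) : ℂ :=
  (2 / hbar : ℝ) *
    ∫ s1, F s1 * G (s - s1) * ((Real.sin (hbar * wedge s s1 / 2) : ℝ) : ℂ)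

section

variable {d : ℕ}

local notation "Phase" d => EuclideanSpace ℝ (Fin d) × EuclideanSpace ℝ (Fin d)

lemma phaseAbs_nonneg (z : Phase d) : 0 ≤ phaseAbs z := by
  unfold phaseAbs; positivity

lemma phaseAbs_add_le (z z' : Phase d) : phaseAbs (z + z') ≤ phaseAbs z + phaseAbs z' := by
  have h1 := norm_add_le z.1 z'.1
  have h2 := norm_add_le z.2 z'.2
  simp only [phaseAbs, Prod.fst_add, Prod.snd_add]
  linarith

lemma measurable_phaseAbs : Measurable (phaseAbs : (Phase d) → ℝ) := by
  unfold phaseAbs; fun_prop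

lemma wedge_sub_self (s t : Phase d) : wedge (s - t) t = wedge s t := by
  simp only [wedge, Prod.fst_sub, Prod.snd_sub, inner_sub_left]
  rw [real_inner_comm t.1 t.2]
  ring

lemma abs_wedge_le (z z' : Phase d) : |wedge z z'| ≤ phaseAbs z * phaseAbs z' := by
  have h1 := abs_real_inner_le_norm z.2 z'.1
  have h2 := abs_real_inner_le_norm z.1 z'.2
  have h3 := abs_sub ⟪z.2, z'.1⟫ ⟪z.1, z'.2⟫
  have h4 : 0 ≤ ‖z.1‖ * ‖z'.1‖ := by positivity
  have h5 : 0 ≤ ‖z.2‖ * ‖z'.2‖ := by positivity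
  simp only [wedge, phaseAbs]
  nlinarith

lemma measurable_wedge : Measurable (fun p : (Phase d) × (Phase d) => wedge p.1 p.2) := by
  unfold wedge; fun_prop

lemma measurable_moyalConv (hbar : ℝ) {F G : (Phase d) → ℂ} (hF : Measurable F)
    (hG : Measurable G) : Measurable (moyalConv hbar F G) := by
  have hw := measurable_wedge (d := d)
  have hK : StronglyMeasurable (Function.uncurry fun s t : Phase d =>
      F t * G (s - t) * ((Real.sin (hbar * wedge s t / 2) : ℝ) : ℂ)) := by
    apply Measurable.stronglyMeasurable
    unfold Function.uncurry
    fun_prop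
  unfold moyalConv
  exact hK.integral_prod_right.measurable.const_mul _

/-- The weighted norm `‖F‖_σ = ∫ e^{σ|s|} |F(s)| ds`, as an extended nonnegative real. -/
noncomputable def expWeightedNorm (σ : ℝ) (F : (Phase d) → ℂ) : ENNReal :=
  ∫⁻ s, ENNReal.ofReal (Real.exp (σ * phaseAbs s) * ‖F s‖)

lemma expWeightedNorm_mono {σ τ : ℝ} (h : σ ≤ τ) (F : (Phase d) → ℂ) :
    expWeightedNorm σ F ≤ expWeightedNorm τ F := by
  refine lintegral_mono fun s => ENNReal.ofReal_le_ofReal ?_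
  have := phaseAbs_nonneg s
  gcongr

lemma mul_exp_neg_mul_le {δ : ℝ} (hδ : 0 < δ) (x : ℝ) :
    x * Real.exp (-(δ * x)) ≤ 1 / (Real.exp 1 * δ) := by
  have h := Real.add_one_le_exp (δ * x - 1)
  rw [Real.exp_sub, sub_add_cancel, le_div_iff₀ (Real.exp_pos 1)] at h
  rw [Real.exp_neg, ← div_eq_mul_inv, div_le_div_iff₀ (Real.exp_pos _) (by positivity)]
  linarith

lemma exp_mul_phaseAbs_mul_kernel_le {hbar τ δ : ℝ} (hhbar : 0 < hbar) (hδ : 0 < δ)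
    (hτ : δ ≤ τ) (s t : Phase d) :
    Real.exp ((τ - δ) * phaseAbs s) * (2 / hbar * |Real.sin (hbar * wedge s t / 2)|) ≤
      1 / (Real.exp 1 ^ 2 * δ ^ 2) *
        (Real.exp (τ * phaseAbs t) * Real.exp (τ * phaseAbs (s - t))) := by
  set a := phaseAbs t
  set b := phaseAbs (s - t)
  have ha : 0 ≤ a := phaseAbs_nonneg t
  have hb : 0 ≤ b := phaseAbs_nonneg (s - t)
  have hs : phaseAbs s ≤ a + b := by
    simpa using phaseAbs_add_le t (s - t)
  have hsin : 2 / hbar * |Real.sin (hbar * wedge s t / 2)| ≤ a * b := by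
    have hw : |wedge s t| ≤ b * a := wedge_sub_self s t ▸ abs_wedge_le (s - t) t
    calc 2 / hbar * |Real.sin (hbar * wedge s t / 2)|
        ≤ 2 / hbar * |hbar * wedge s t / 2| := by
          gcongr 2 / hbar * ?_
          exact Real.abs_sin_le_abs
      _ = |wedge s t| := by
          rw [abs_div, abs_mul, abs_of_pos hhbar, abs_of_pos (zero_lt_two' ℝ)]
          field_simp
      _ ≤ a * b := by linarith
  have hexp : Real.exp ((τ - δ) * phaseAbs s) ≤ Real.exp ((τ - δ) * (a + b)) :=
    Real.exp_le_exp.2 (mul_le_mul_of_nonneg_left hs (sub_nonneg.2 hτ))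
  calc Real.exp ((τ - δ) * phaseAbs s) * (2 / hbar * |Real.sin (hbar * wedge s t / 2)|)
      ≤ Real.exp ((τ - δ) * (a + b)) * (a * b) := by gcongr
    _ = (a * Real.exp (-(δ * a))) * (b * Real.exp (-(δ * b))) *
          (Real.exp (τ * a) * Real.exp (τ * b)) := by
        rw [show (τ - δ) * (a + b) = -(δ * a) + -(δ * b) + (τ * a + τ * b) by ring,
          Real.exp_add, Real.exp_add, Real.exp_add]
        ring
    _ ≤ 1 / (Real.exp 1 * δ) * (1 / (Real.exp 1 * δ)) *
          (Real.exp (τ * a) * Real.exp (τ * b)) := by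
        gcongr
        · exact mul_exp_neg_mul_le hδ a
        · exact mul_exp_neg_mul_le hδ b
    _ = _ := by
        congr 1
        field_simp

lemma lintegral_lintegral_mul_sub {A B : (Phase d) → ENNReal} (hA : Measurable A)
    (hB : Measurable B) :
    ∫⁻ s, ∫⁻ t, A t * B (s - t) = (∫⁻ t, A t) * ∫⁻ t, B t := by
  rw [lintegral_lintegral_swap (by unfold Function.uncurry; fun_prop)]
  have : (volume : Measure (Phase d)).IsAddHaarMeasure :=
    Measure.prod.instIsAddHaarMeasure volume volume
  have h (t : Phase d) : ∫⁻ s, A t * B (s - t) = A t * ∫⁻ s, B s := by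
    rw [lintegral_const_mul _ (by fun_prop), lintegral_sub_right_eq_self]
  simp_rw [h]
  exact lintegral_mul_const _ hA

/-- The one-step Moyal bracket estimate with loss `δ`. -/
lemma expWeightedNorm_moyalConv_le {hbar τ δ : ℝ} (hhbar : 0 < hbar) (hδ : 0 < δ)
    (hτ : δ ≤ τ) {F G : (Phase d) → ℂ} (hF : Measurable F) (hG : Measurable G) :
    expWeightedNorm (τ - δ) (moyalConv hbar F G) ≤
      ENNReal.ofReal (1 / (Real.exp 1 ^ 2 * δ ^ 2)) *
        (expWeightedNorm τ F * expWeightedNorm τ G) := by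
  have hp := measurable_phaseAbs (d := d)
  let A (t : Phase d) := ENNReal.ofReal (Real.exp (τ * phaseAbs t) * ‖F t‖)
  let B (t : Phase d) := ENNReal.ofReal (Real.exp (τ * phaseAbs t) * ‖G t‖)
  have hA : Measurable A := by fun_prop
  have hB : Measurable B := by fun_prop
  have hpoint (s : Phase d) :
      ENNReal.ofReal (Real.exp ((τ - δ) * phaseAbs s) * ‖moyalConv hbar F G s‖) ≤
        ENNReal.ofReal (1 / (Real.exp 1 ^ 2 * δ ^ 2)) * ∫⁻ t, A t * B (s - t) := by
    have hc : 0 ≤ Real.exp ((τ - δ) * phaseAbs s) * (2 / hbar) := by positivity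
    rw [moyalConv, norm_mul, Complex.norm_real, Real.norm_of_nonneg (by positivity),
      ← mul_assoc, ENNReal.ofReal_mul hc, ofReal_norm]
    refine (mul_le_mul_right (enorm_integral_le_lintegral_enorm _) _).trans ?_
    rw [← lintegral_const_mul' _ _ ENNReal.ofReal_ne_top,
      ← lintegral_const_mul' _ _ ENNReal.ofReal_ne_top]
    refine lintegral_mono fun t => ?_
    simp only [A, B]
    rw [← ofReal_norm, ← ENNReal.ofReal_mul hc, ← ENNReal.ofReal_mul (by positivity),
      ← ENNReal.ofReal_mul (by positivity), norm_mul, norm_mul, Complex.norm_real,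
      Real.norm_eq_abs]
    refine ENNReal.ofReal_le_ofReal ?_
    have h := mul_le_mul_of_nonneg_right (exp_mul_phaseAbs_mul_kernel_le hhbar hδ hτ s t)
      (mul_nonneg (norm_nonneg (F t)) (norm_nonneg (G (s - t))))
    linarith
  refine (lintegral_mono hpoint).trans ?_
  rw [lintegral_const_mul' _ _ ENNReal.ofReal_ne_top, lintegral_lintegral_mul_sub hA hB]
  rfl

end

/-- Iterated Moyal bracket estimate, uniform in `hbar`: applying the one-step estimate
`r` times with loss `δ` per step, `‖H_r‖_{σ-rδ} ≤ (1/(e²δ²))^r ‖F‖_σ^r ‖G‖_σ`. -/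
theorem iterated_moyal_bracket_estimate (d : ℕ) (hd : 1 ≤ d) (hbar σ δ : ℝ) (r : ℕ)
    (hhbar : 0 < hbar) (hσ : 0 < σ) (hδ0 : 0 < δ) (hr : 1 ≤ r) (hrδ : r * δ < σ)
    (F G : EuclideanSpace ℝ (Fin d) × EuclideanSpace ℝ (Fin d) → ℂ)
    (hF : Measurable F) (hG : Measurable G)
    (hFσ : Integrable (fun s => Real.exp (σ * phaseAbs s) * ‖F s‖) volume)
    (hGσ : Integrable (fun s => Real.exp (σ * phaseAbs s) * ‖G s‖) volume)
    (H : ℕ → EuclideanSpace ℝ (Fin d) × EuclideanSpace ℝ (Fin d) → ℂ)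
    (hH0 : H 0 = G) (hHrec : ∀ k : ℕ, H (k + 1) = moyalConv hbar F (H k)) :
    (∫⁻ s, ENNReal.ofReal
        (Real.exp ((σ - r * δ) * phaseAbs s) * ‖H r s‖) ∂volume) ≤
      ENNReal.ofReal ((1 / (Real.exp 1 ^ 2 * δ ^ 2)) ^ r *
        (∫ s, Real.exp (σ * phaseAbs s) * ‖F s‖) ^ r *
        (∫ s, Real.exp (σ * phaseAbs s) * ‖G s‖)) := by
  have hmeas (k : ℕ) : Measurable (H k) := by
    induction k with
    | zero => exact hH0 ▸ hG
    | succ k ih => exact hHrec k ▸ measurable_moyalConv hbar hF ih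
  have hiter (k : ℕ) (hk : k ≤ r) : expWeightedNorm (σ - k * δ) (H k) ≤
      ENNReal.ofReal (1 / (Real.exp 1 ^ 2 * δ ^ 2)) ^ k * expWeightedNorm σ F ^ k *
        expWeightedNorm σ G := by
    induction k with
    | zero => simp [hH0]
    | succ k ih =>
      have hkr : ((k + 1 : ℕ) : ℝ) * δ ≤ r * δ := by gcongr
      push_cast at hkr ⊢
      have hkδ : 0 ≤ k * δ := by positivity
      rw [hHrec k, show σ - (k + 1) * δ = σ - k * δ - δ by ring]
      calc expWeightedNorm (σ - k * δ - δ) (moyalConv hbar F (H k))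
          ≤ ENNReal.ofReal (1 / (Real.exp 1 ^ 2 * δ ^ 2)) *
              (expWeightedNorm (σ - k * δ) F * expWeightedNorm (σ - k * δ) (H k)) :=
            expWeightedNorm_moyalConv_le hhbar hδ0 (by linarith) hF (hmeas k)
        _ ≤ ENNReal.ofReal (1 / (Real.exp 1 ^ 2 * δ ^ 2)) *
              (expWeightedNorm σ F *
                (ENNReal.ofReal (1 / (Real.exp 1 ^ 2 * δ ^ 2)) ^ k * expWeightedNorm σ F ^ k *
                  expWeightedNorm σ G)) := by
            gcongr
            · exact expWeightedNorm_mono (by linarith) F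
            · exact ih (by omega)
        _ = _ := by ring
  have hnorm {K : EuclideanSpace ℝ (Fin d) × EuclideanSpace ℝ (Fin d) → ℂ}
      (hK : Integrable (fun s => Real.exp (σ * phaseAbs s) * ‖K s‖) volume) :
      expWeightedNorm σ K = ENNReal.ofReal (∫ s, Real.exp (σ * phaseAbs s) * ‖K s‖) :=
    (ofReal_integral_eq_lintegral_ofReal hK (.of_forall fun s => by positivity)).symm
  have hF0 : 0 ≤ ∫ s, Real.exp (σ * phaseAbs s) * ‖F s‖ :=
    integral_nonneg fun s => by positivity
  rw [ENNReal.ofReal_mul (by positivity), ENNReal.ofReal_mul (by positivity),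
    ENNReal.ofReal_pow (by positivity), ENNReal.ofReal_pow hF0, ← hnorm hFσ, ← hnorm hGσ]
  exact hiter r le_rfl
end

section
/- For every real ε ∈ (0,1], one has ∑_{n=1}^{⌊ε^{−1/2}⌋} (n!)² (2ε)^n ≤ 2e⁴/(e² − 2)². In particular this sum is bounded uniformly in ε ∈ (0,1]. -/
/-- The upper Stirling bound `n! ≤ e √n (n/e)ⁿ`. -/
theorem factorial_le_exp_one_mul_sqrt_mul_pow {n : ℕ} (hn : n ≠ 0) :
    (n.factorial : ℝ) ≤ Real.exp 1 * √n * (n / Real.exp 1) ^ n := by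
  obtain ⟨m, rfl⟩ := Nat.exists_eq_succ_of_ne_zero hn
  have h : Stirling.stirlingSeq (m + 1) ≤ Stirling.stirlingSeq 1 :=
    Stirling.stirlingSeq'_antitone (Nat.zero_le m)
  rw [Stirling.stirlingSeq_one, Stirling.stirlingSeq, div_le_iff₀ (by positivity),
    Real.sqrt_mul (by norm_num)] at h
  refine h.trans_eq ?_
  have h2 : √(2 : ℝ) ≠ 0 := by positivity
  field_simp

/-- If `n² ε ≤ 1`, then `(n!)² (2ε)ⁿ` is dominated by `e² n (2/e²)ⁿ`. -/
theorem factorial_sq_mul_pow_le {ε : ℝ} (hε : 0 ≤ ε) {n : ℕ} (hn : n ≠ 0)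
    (hnε : (n : ℝ) ^ 2 * ε ≤ 1) :
    (n.factorial : ℝ) ^ 2 * (2 * ε) ^ n ≤
      Real.exp 1 ^ 2 * (n * (2 / Real.exp 1 ^ 2) ^ n) := by
  calc (n.factorial : ℝ) ^ 2 * (2 * ε) ^ n
      ≤ (Real.exp 1 * √n * (n / Real.exp 1) ^ n) ^ 2 * (2 * ε) ^ n := by
        gcongr
        exact factorial_le_exp_one_mul_sqrt_mul_pow hn
    _ = Real.exp 1 ^ 2 * (n * (2 / Real.exp 1 ^ 2) ^ n) * ((n : ℝ) ^ 2 * ε) ^ n := by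
        rw [mul_pow, mul_pow, Real.sq_sqrt n.cast_nonneg, pow_right_comm,
          mul_assoc (_ * _), ← mul_pow, mul_assoc, mul_assoc, mul_assoc, ← mul_pow]
        congr 3
        ring
    _ ≤ Real.exp 1 ^ 2 * (n * (2 / Real.exp 1 ^ 2) ^ n) :=
        mul_le_of_le_one_right (by positivity) (pow_le_one₀ (by positivity) hnε)

/-- The truncated sum `∑_{n=1}^{⌊ε^{-1/2}⌋} (n!)² (2ε)ⁿ` is bounded by
`2e⁴/(e² - 2)²`, uniformly in `ε ∈ (0,1]`. -/
theorem loop_sum_uniform_bound (ε : ℝ) (hε0 : 0 < ε) (hε1 : ε ≤ 1) :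
    (∑ n ∈ Finset.Icc 1 ⌊(Real.sqrt ε)⁻¹⌋₊, (n.factorial : ℝ) ^ 2 * (2 * ε) ^ n) ≤
      2 * Real.exp 1 ^ 4 / (Real.exp 1 ^ 2 - 2) ^ 2 := by
  have he : 2 < Real.exp 1 ^ 2 := by nlinarith [Real.exp_one_gt_two]
  have hr : ‖2 / Real.exp 1 ^ 2‖ < 1 := by
    rw [Real.norm_of_nonneg (by positivity), div_lt_one (by positivity)]
    exact he
  have hsum := (hasSum_coe_mul_geometric_of_norm_lt_one hr).mul_left (Real.exp 1 ^ 2)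
  calc _ ≤ ∑ n ∈ Finset.Icc 1 ⌊(√ε)⁻¹⌋₊, Real.exp 1 ^ 2 * (n * (2 / Real.exp 1 ^ 2) ^ n) := by
        refine Finset.sum_le_sum fun n hn => ?_
        obtain ⟨hn1, hn2⟩ := Finset.mem_Icc.mp hn
        refine factorial_sq_mul_pow_le hε0.le (Nat.one_le_iff_ne_zero.mp hn1) ?_
        have hle : (n : ℝ) ≤ (√ε)⁻¹ := (Nat.le_floor_iff (by positivity)).mp hn2
        calc (n : ℝ) ^ 2 * ε ≤ (√ε)⁻¹ ^ 2 * ε := by gcongr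
          _ = 1 := by rw [inv_pow, Real.sq_sqrt hε0.le, inv_mul_cancel₀ hε0.ne']
    _ ≤ _ := sum_le_hasSum _ (fun n _ => by positivity) hsum
    _ = _ := by
        have h1 : Real.exp 1 ^ 2 - 2 ≠ 0 := (sub_pos.mpr he).ne'
        rw [one_sub_div (by positivity)]
        field_simp
end
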